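/- arXiv:2202.04954 — 5 statements merged into one kernel-verified Lean document; each statement's English description precedes it below -/
import Mathlib

section
/- (Theorem 4, upper bound on the measurement likelihood) Suppose σ > 0 and α : L → ℝ satisfy ζ i j ≤ σ·α i for all i ∈ L, j ∈ M. Then for every nonempty subset S ⊆ M, η ≤ ηˢ·W + (1 − W)·σ·∑_{i∈L} α i, i.e. the quantity UB[η] := ηˢ·W + (1 − W)·σ·∑_{i∈L} α i is an upper bound on the measurement likelihood η. -/
/-- Theorem 4 (upper bound on the measurement likelihood):
`η ≤ ηˢ·W + (1 − W)·σ·∑_{i∈L} α i`. -/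
theorem eta_upper_bound
    {L M : Type*} [Fintype L] [Fintype M] [Nonempty L] [Nonempty M]
    (w : M → ℝ) (ζ : L → M → ℝ)
    (hw : ∀ j, 0 < w j) (hw1 : ∑ j, w j = 1)
    (hζ : ∀ i j, 0 < ζ i j)
    (σ : ℝ) (α : L → ℝ) (hσ : 0 < σ)
    (hζσα : ∀ i j, ζ i j ≤ σ * α i)
    (S : Finset M) (hS : S.Nonempty)
    (W η ηs : ℝ) (ws : M → ℝ)
    (hW : W = ∑ j ∈ S, w j)
    (hws : ∀ j, ws j = w j / W)
    (hη : η = ∑ i, ∑ j, ζ i j * w j)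
    (hηs : ηs = ∑ i, ∑ j ∈ S, ζ i j * ws j) :
    η ≤ ηs * W + (1 - W) * σ * ∑ i, α i := by
  classical
  have hW0 : W ≠ 0 := hW ▸ (Finset.sum_pos (fun j _ => hw j) hS).ne'
  have hcompl : ∑ j ∈ Sᶜ, w j = 1 - W := by
    rw [hW, ← hw1, ← Finset.sum_add_sum_compl S w]
    ring
  have hretained : ηs * W = ∑ i, ∑ j ∈ S, ζ i j * w j := by
    simp only [hηs, hws, Finset.sum_mul, mul_assoc, div_mul_cancel₀ _ hW0]
  have hdiscarded : ∑ i, ∑ j ∈ Sᶜ, ζ i j * w j ≤ (1 - W) * σ * ∑ i, α i := by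
    rw [Finset.mul_sum]
    refine Finset.sum_le_sum fun i _ => ?_
    calc ∑ j ∈ Sᶜ, ζ i j * w j ≤ ∑ j ∈ Sᶜ, σ * α i * w j :=
          Finset.sum_le_sum fun j _ => mul_le_mul_of_nonneg_right (hζσα i j) (hw j).le
      _ = (1 - W) * σ * α i := by
          rw [← Finset.mul_sum, hcompl]
          ring
  calc η = ∑ i, ∑ j ∈ S, ζ i j * w j + ∑ i, ∑ j ∈ Sᶜ, ζ i j * w j := by
        simp only [hη, ← Finset.sum_add_distrib, Finset.sum_add_sum_compl]
    _ ≤ ηs * W + (1 - W) * σ * ∑ i, α i := by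
        rw [hretained]
        gcongr
end

section
/- (Theorem 1, analytic decomposition of the posterior entropy) For every nonempty subset S ⊆ M, the posterior entropy satisfies the identity H = (W/η)·[ ηˢ·(Hˢ − log ηˢ) − (∑_{i∈L} ∑_{j∈S} ζ i j · wˢ j)·log(W/η) ] − ∑_{i∈L} ∑_{j∈M\S} (ζ i j · w j / η)·log(ζ i j · w j / η). -/
/-- Rescaling a positive term `a` by `c > 0` in `x ↦ x * log x`, relative to a normalizer `n`. -/
theorem mul_mul_log_eq_add {a c n : ℝ} (ha : 0 < a) (hc : 0 < c) (hn : 0 < n) :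
    (c * a) * Real.log (c * a) =
      c * (n * ((a / n) * Real.log (a / n)) + a * (Real.log n + Real.log c)) := by
  rw [Real.log_mul hc.ne' ha.ne', Real.log_div ha.ne' hn.ne']
  field_simp
  ring

/-- Theorem 1 (analytic decomposition of the posterior entropy):
`H = (W/η)·[ηˢ·(Hˢ − log ηˢ) − (∑_{i∈L}∑_{j∈S} ζ i j · wˢ j)·log(W/η)]
   − ∑_{i∈L}∑_{j∈M\S} (ζ i j · w j / η)·log(ζ i j · w j / η)`. -/
theorem entropy_decomposition
    {L M : Type*} [Fintype L] [Fintype M] [DecidableEq M] [Nonempty L] [Nonempty M]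
    (w : M → ℝ) (ζ : L → M → ℝ)
    (hw : ∀ j, 0 < w j) (hw1 : ∑ j, w j = 1)
    (hζ : ∀ i j, 0 < ζ i j)
    (S : Finset M) (hS : S.Nonempty)
    (W η ηs H Hs : ℝ) (ws : M → ℝ)
    (hW : W = ∑ j ∈ S, w j)
    (hws : ∀ j, ws j = w j / W)
    (hη : η = ∑ i, ∑ j, ζ i j * w j)
    (hηs : ηs = ∑ i, ∑ j ∈ S, ζ i j * ws j)
    (hH : H = -∑ i, ∑ j, (ζ i j * w j / η) * Real.log (ζ i j * w j / η))
    (hHs : Hs = -∑ i, ∑ j ∈ S, (ζ i j * ws j / ηs) * Real.log (ζ i j * ws j / ηs)) :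
    H = (W / η) * (ηs * (Hs - Real.log ηs)
          - (∑ i, ∑ j ∈ S, ζ i j * ws j) * Real.log (W / η))
      - ∑ i, ∑ j ∈ Sᶜ, (ζ i j * w j / η) * Real.log (ζ i j * w j / η) := by
  have hWpos : 0 < W := hW ▸ Finset.sum_pos (fun j _ => hw j) hS
  have hηpos : 0 < η := hη ▸ Finset.sum_pos
    (fun i _ => Finset.sum_pos (fun j _ => mul_pos (hζ i j) (hw j)) Finset.univ_nonempty)
    Finset.univ_nonempty
  have ha : ∀ i j, 0 < ζ i j * ws j := fun i j =>
    mul_pos (hζ i j) (hws j ▸ div_pos (hw j) hWpos)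
  have hηspos : 0 < ηs := hηs ▸ Finset.sum_pos
    (fun i _ => Finset.sum_pos (fun j _ => ha i j) hS) Finset.univ_nonempty
  have hscale : ∀ i j, ζ i j * w j / η = W / η * (ζ i j * ws j) := fun i j => by
    rw [hws]
    field_simp
  have hretained : ∑ i, ∑ j ∈ S, (ζ i j * w j / η) * Real.log (ζ i j * w j / η) =
      W / η * (ηs * -Hs + ηs * (Real.log ηs + Real.log (W / η))) := by
    simp_rw [hscale, mul_mul_log_eq_add (ha _ _) (div_pos hWpos hηpos) hηspos,
      ← Finset.mul_sum, Finset.sum_add_distrib, ← Finset.mul_sum, ← Finset.sum_mul]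
    rw [← hηs, hHs, neg_neg]
  rw [hH, ← hηs]
  simp_rw [← Finset.sum_add_sum_compl S, Finset.sum_add_distrib]
  rw [hretained]
  ring
end

section
/- (Theorem 2, lower bound on the posterior entropy) Suppose σ > 0 and α : L → ℝ satisfy ζ i j ≤ σ·α i for all i ∈ L, j ∈ M, and set LB[η] := ηˢ·W and UB[η] := ηˢ·W + (1 − W)·σ·∑_{i∈L} α i. Assume additionally that ηˢ ≥ 1 and Hˢ ≥ log ηˢ. Then (ηˢ·W/UB[η])·(Hˢ − log ηˢ) − (W/UB[η])·(∑_{i∈L} ∑_{j∈S} ζ i j · wˢ j)·log(W/LB[η]) ≤ H. -/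
/-- Theorem 2 (lower bound on the posterior entropy):
`(ηˢ·W/UB[η])·(Hˢ − log ηˢ) − (W/UB[η])·(∑_{i∈L}∑_{j∈S} ζ i j · wˢ j)·log(W/LB[η]) ≤ H`. -/
theorem entropy_lower_bound
    {L M : Type*} [Fintype L] [Fintype M] [Nonempty L] [Nonempty M]
    (w : M → ℝ) (ζ : L → M → ℝ)
    (hw : ∀ j, 0 < w j) (hw1 : ∑ j, w j = 1)
    (hζ : ∀ i j, 0 < ζ i j)
    (σ : ℝ) (α : L → ℝ) (hσ : 0 < σ)
    (hζσα : ∀ i j, ζ i j ≤ σ * α i)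
    (S : Finset M) (hS : S.Nonempty)
    (W η ηs H Hs LB UB : ℝ) (ws : M → ℝ)
    (hW : W = ∑ j ∈ S, w j)
    (hws : ∀ j, ws j = w j / W)
    (hη : η = ∑ i, ∑ j, ζ i j * w j)
    (hηs : ηs = ∑ i, ∑ j ∈ S, ζ i j * ws j)
    (hH : H = -∑ i, ∑ j, (ζ i j * w j / η) * Real.log (ζ i j * w j / η))
    (hHs : Hs = -∑ i, ∑ j ∈ S, (ζ i j * ws j / ηs) * Real.log (ζ i j * ws j / ηs))
    (hLB : LB = ηs * W)
    (hUB : UB = ηs * W + (1 - W) * σ * ∑ i, α i)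
    (hηs1 : 1 ≤ ηs)
    (hHslog : Real.log ηs ≤ Hs) :
    (ηs * W / UB) * (Hs - Real.log ηs)
      - (W / UB) * (∑ i, ∑ j ∈ S, ζ i j * ws j) * Real.log (W / LB) ≤ H := by
  have hWpos : 0 < W := hW ▸ Finset.sum_pos (fun j _ => hw j) hS
  have hηspos : 0 < ηs := by linarith
  have hlogηs : 0 ≤ Real.log ηs := Real.log_nonneg hηs1
  have hmass : ∑ i, ∑ j ∈ S, ζ i j * w j = ηs * W := by
    simp only [hηs, hws, Finset.sum_mul]
    refine Finset.sum_congr rfl fun i _ => Finset.sum_congr rfl fun j _ => ?_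
    field_simp
  have hterm : ∀ i j, 0 < ζ i j * w j := fun i j => mul_pos (hζ i j) (hw j)
  have hle : ηs * W ≤ η := by
    rw [← hmass, hη]
    exact Finset.sum_le_sum fun i _ =>
      Finset.sum_le_univ_sum_of_nonneg fun j => (hterm i j).le
  have hηpos : 0 < η := (mul_pos hηspos hWpos).trans_le hle
  have hηUB : η ≤ UB := by
    classical
    have hcompl : ∑ j ∈ Sᶜ, w j = 1 - W := by
      rw [hW, ← hw1, ← Finset.sum_add_sum_compl S w]
      ring
    rw [hUB, ← hmass, ← hcompl, hη, Finset.mul_sum, ← Finset.sum_add_distrib]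
    refine Finset.sum_le_sum fun i _ => ?_
    rw [← Finset.sum_add_sum_compl S, mul_assoc, Finset.sum_mul]
    refine (add_le_add_iff_left _).2 (Finset.sum_le_sum fun j _ => ?_)
    rw [mul_comm]
    exact mul_le_mul_of_nonneg_left (hζσα i j) (hw j).le
  have hle_one : ∀ i j, ζ i j * w j / η ≤ 1 := fun i j => by
    rw [div_le_one hηpos, hη]
    calc ζ i j * w j ≤ ∑ j, ζ i j * w j :=
          Finset.single_le_sum (fun j _ => (hterm i j).le) (Finset.mem_univ j)
      _ ≤ _ := Finset.single_le_sum (f := fun i => ∑ j, ζ i j * w j)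
          (fun i _ => Finset.sum_nonneg fun j _ => (hterm i j).le) (Finset.mem_univ i)
  have hHs' : Hs = ∑ i, ∑ j ∈ S, Real.negMulLog (ζ i j * ws j / ηs) := by
    simp only [hHs, Real.negMulLog, neg_mul, Finset.sum_neg_distrib]
  have hH' : ∑ i, ∑ j ∈ S, Real.negMulLog (ζ i j * w j / η) ≤ H := by
    have : H = ∑ i, ∑ j, Real.negMulLog (ζ i j * w j / η) := by
      simp only [hH, Real.negMulLog, neg_mul, Finset.sum_neg_distrib]
    rw [this]
    exact Finset.sum_le_sum fun i _ => Finset.sum_le_univ_sum_of_nonneg fun j =>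
      Real.negMulLog_nonneg (div_pos (hterm i j) hηpos).le (hle_one i j)
  have hsum_one : ∑ i, ∑ j ∈ S, ζ i j * ws j / ηs = 1 := by
    simp only [← Finset.sum_div]
    rw [← hηs, div_self hηspos.ne']
  have hgroup : ∑ i, ∑ j ∈ S, Real.negMulLog (ζ i j * w j / η)
      = ηs * W / η * Hs + Real.negMulLog (ηs * W / η) := by
    have hsplit : ∀ i j, Real.negMulLog (ζ i j * w j / η)
        = ηs * W / η * Real.negMulLog (ζ i j * ws j / ηs)
          + ζ i j * ws j / ηs * Real.negMulLog (ηs * W / η) := fun i j => by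
      have : ζ i j * w j / η = ζ i j * ws j / ηs * (ηs * W / η) := by
        rw [hws]
        field_simp
      rw [this, Real.negMulLog_mul]
    simp only [hsplit, Finset.sum_add_distrib, ← Finset.mul_sum, ← Finset.sum_mul]
    rw [← hHs', hsum_one, one_mul]
  have hneg : 0 ≤ Real.negMulLog (ηs * W / η) :=
    Real.negMulLog_nonneg (by positivity) ((div_le_one hηpos).2 hle)
  have hlog : Real.log (W / LB) = -Real.log ηs := by
    rw [hLB, ← Real.log_inv]
    congr 1
    field_simp
  calc (ηs * W / UB) * (Hs - Real.log ηs)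
        - (W / UB) * (∑ i, ∑ j ∈ S, ζ i j * ws j) * Real.log (W / LB)
      = ηs * W / UB * Hs := by rw [hlog, ← hηs]; ring
    _ ≤ ηs * W / η * Hs := by
        have : 0 ≤ Hs := hlogηs.trans hHslog
        gcongr
    _ ≤ H := by linarith
end

section
/- (Theorem 2, upper bound on the posterior entropy) Suppose σ > 0 and α : L → ℝ satisfy ζ i j ≤ σ·α i for all i ∈ L, j ∈ M, and set LB[η] := ηˢ·W, UB[η] := ηˢ·W + (1 − W)·σ·∑_{i∈L} α i, and γ := 1 − ηˢ·W/UB[η]. Assume additionally that S ≠ M, that ηˢ ≥ 1 and Hˢ ≥ log ηˢ, and that |L|·|M\S| ≥ 3. Then H ≤ (ηˢ·W/LB[η])·(Hˢ − log ηˢ) − (W/LB[η])·(∑_{i∈L} ∑_{j∈S} ζ i j · wˢ j)·log(W/UB[η]) − γ·log(γ/(|L|·|M\S|)). -/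
/-- Tangent-line bound for the concave function `x ↦ -x log x`, with tangency point `c`. -/
theorem neg_mul_log_le_tangent {p c : ℝ} (hp : 0 < p) (hc : 0 < c) :
    -(p * Real.log p) ≤ -(p * Real.log c) + c - p := by
  have h := Real.log_le_sub_one_of_pos (div_pos hc hp)
  rw [Real.log_div hc.ne' hp.ne'] at h
  have h' := mul_le_mul_of_nonneg_left h hp.le
  have e : p * (c / p - 1) = c - p := by field_simp
  rw [e] at h'
  linarith

/-- Positive masses with total at most `t ≤ 1`, spread over at least three points, have total
entropy at most that of the uniform distribution of `t`. -/
theorem neg_sum_mul_log_le_uniform {ι : Type*} (T : Finset ι) (p : ι → ℝ) {t : ℝ}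
    (hp : ∀ k ∈ T, 0 < p k) (ht : 0 < t) (ht1 : t ≤ 1) (hsum : ∑ k ∈ T, p k ≤ t)
    (hT : 3 ≤ T.card) :
    -∑ k ∈ T, p k * Real.log (p k) ≤ -(t * Real.log (t / T.card)) := by
  have hN : (3 : ℝ) ≤ T.card := by exact_mod_cast hT
  have hN0 : (0 : ℝ) < T.card := by linarith
  have hc : 0 < t / T.card := div_pos ht hN0
  have hlog : Real.log (t / T.card) ≤ -1 := by
    rw [Real.log_le_iff_le_exp hc, Real.exp_neg, div_le_iff₀ hN0]
    have he : Real.exp 1 ≤ T.card := by linarith [Real.exp_one_lt_d9]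
    calc t ≤ 1 := ht1
      _ = (Real.exp 1)⁻¹ * Real.exp 1 := (inv_mul_cancel₀ (Real.exp_pos 1).ne').symm
      _ ≤ (Real.exp 1)⁻¹ * T.card := by gcongr
  have hle : -∑ k ∈ T, p k * Real.log (p k) ≤
      -((∑ k ∈ T, p k) * Real.log (t / T.card)) + t - ∑ k ∈ T, p k := by
    calc -∑ k ∈ T, p k * Real.log (p k) = ∑ k ∈ T, -(p k * Real.log (p k)) := by
          rw [Finset.sum_neg_distrib]
      _ ≤ ∑ k ∈ T, (-(p k * Real.log (t / T.card)) + t / T.card - p k) :=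
          Finset.sum_le_sum fun k hk => neg_mul_log_le_tangent (hp k hk) hc
      _ = _ := by
          rw [Finset.sum_sub_distrib, Finset.sum_add_distrib, Finset.sum_neg_distrib,
            ← Finset.sum_mul, Finset.sum_const, nsmul_eq_mul, mul_div_cancel₀ _ hN0.ne']
  nlinarith


/-- Theorem 2 (upper bound on the posterior entropy):
`H ≤ (ηˢ·W/LB[η])·(Hˢ − log ηˢ) − (W/LB[η])·(∑_{i∈L}∑_{j∈S} ζ i j · wˢ j)·log(W/UB[η])
     − γ·log(γ/(|L|·|M\S|))`. -/
theorem entropy_upper_bound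
    {L M : Type*} [Fintype L] [Fintype M] [DecidableEq M] [Nonempty L] [Nonempty M]
    (w : M → ℝ) (ζ : L → M → ℝ)
    (hw : ∀ j, 0 < w j) (hw1 : ∑ j, w j = 1)
    (hζ : ∀ i j, 0 < ζ i j)
    (σ : ℝ) (α : L → ℝ) (hσ : 0 < σ)
    (hζσα : ∀ i j, ζ i j ≤ σ * α i)
    (S : Finset M) (hS : S.Nonempty) (hSne : S ≠ Finset.univ)
    (W η ηs H Hs LB UB γ : ℝ) (ws : M → ℝ)
    (hW : W = ∑ j ∈ S, w j)
    (hws : ∀ j, ws j = w j / W)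
    (hη : η = ∑ i, ∑ j, ζ i j * w j)
    (hηs : ηs = ∑ i, ∑ j ∈ S, ζ i j * ws j)
    (hH : H = -∑ i, ∑ j, (ζ i j * w j / η) * Real.log (ζ i j * w j / η))
    (hHs : Hs = -∑ i, ∑ j ∈ S, (ζ i j * ws j / ηs) * Real.log (ζ i j * ws j / ηs))
    (hLB : LB = ηs * W)
    (hUB : UB = ηs * W + (1 - W) * σ * ∑ i, α i)
    (hγ : γ = 1 - ηs * W / UB)
    (hηs1 : 1 ≤ ηs)
    (hHslog : Real.log ηs ≤ Hs)
    (hcard : 3 ≤ Fintype.card L * Sᶜ.card) :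
    H ≤ (ηs * W / LB) * (Hs - Real.log ηs)
      - (W / LB) * (∑ i, ∑ j ∈ S, ζ i j * ws j) * Real.log (W / UB)
      - γ * Real.log (γ / ((Fintype.card L : ℝ) * (Sᶜ.card : ℝ))) := by
  have hW0 : 0 < W := hW ▸ Finset.sum_pos (fun j _ => hw j) hS
  have hηs0 : 0 < ηs := by linarith
  have hζw : ∀ i j, 0 < ζ i j * w j := fun i j => mul_pos (hζ i j) (hw j)
  have hWc : ∑ j ∈ Sᶜ, w j = 1 - W := by
    rw [hW, ← hw1, ← Finset.sum_add_sum_compl S w]; ring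
  have hws' : ∑ i, ∑ j ∈ S, ζ i j * ws j = ηs := hηs.symm
  have hLB0 : 0 < LB := hLB ▸ mul_pos hηs0 hW0
  have hA : ∑ i, ∑ j ∈ S, ζ i j * w j = LB := by
    rw [hLB, hηs, Finset.sum_mul]
    refine Finset.sum_congr rfl fun i _ => ?_
    rw [Finset.sum_mul]
    refine Finset.sum_congr rfl fun j _ => ?_
    rw [hws]; field_simp
  have hsplit : ∀ f : L → M → ℝ,
      ∑ i, ∑ j, f i j = ∑ i, ∑ j ∈ S, f i j + ∑ i, ∑ j ∈ Sᶜ, f i j := fun f => by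
    rw [← Finset.sum_add_distrib]
    exact Finset.sum_congr rfl fun i _ => (Finset.sum_add_sum_compl S _).symm
  have hSc : Sᶜ.Nonempty := by
    rwa [Finset.nonempty_iff_ne_empty, Ne, Finset.compl_eq_empty_iff]
  have hB0 : 0 < ∑ i, ∑ j ∈ Sᶜ, ζ i j * w j :=
    Finset.sum_pos (fun i _ => Finset.sum_pos (fun j _ => hζw i j) hSc) Finset.univ_nonempty
  have hB : ∑ i, ∑ j ∈ Sᶜ, ζ i j * w j ≤ (1 - W) * σ * ∑ i, α i := by
    rw [Finset.mul_sum]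
    refine Finset.sum_le_sum fun i _ => ?_
    calc ∑ j ∈ Sᶜ, ζ i j * w j ≤ ∑ j ∈ Sᶜ, (σ * α i) * w j :=
          Finset.sum_le_sum fun j _ => mul_le_mul_of_nonneg_right (hζσα i j) (hw j).le
      _ = (1 - W) * σ * α i := by rw [← Finset.mul_sum, hWc]; ring
  have hηe : η = LB + ∑ i, ∑ j ∈ Sᶜ, ζ i j * w j := by rw [hη, hsplit, hA]
  have hη0 : 0 < η := by linarith
  have hηUB : η ≤ UB := by rw [hUB, ← hLB]; linarith
  have hUB0 : 0 < UB := by linarith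
  rw [← hLB] at hγ ⊢
  have hfrac : LB / UB ≤ LB / η := by gcongr
  have hγ0 : 0 < γ := by
    have : LB / UB < 1 := (div_lt_one hUB0).2 (by linarith)
    linarith
  have hγ1 : γ ≤ 1 := by linarith [div_pos hLB0 hUB0]
  -- the discarded hypotheses
  have htail : -∑ i, ∑ j ∈ Sᶜ, (ζ i j * w j / η) * Real.log (ζ i j * w j / η) ≤
      -(γ * Real.log (γ / ((Fintype.card L : ℝ) * (Sᶜ.card : ℝ)))) := by
    have h := neg_sum_mul_log_le_uniform (Finset.univ ×ˢ Sᶜ)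
      (fun k : L × M => ζ k.1 k.2 * w k.2 / η) (t := γ)
      (fun k _ => div_pos (hζw k.1 k.2) hη0) hγ0 hγ1
      (by
        rw [Finset.sum_product, hγ]
        simp only [← Finset.sum_div]
        have : (∑ i, ∑ j ∈ Sᶜ, ζ i j * w j) / η = 1 - LB / η := by
          rw [hηe] at hη0 ⊢
          field_simp
          ring
        linarith)
      (by rwa [Finset.card_product, Finset.card_univ])
    rwa [Finset.sum_product, Finset.card_product, Finset.card_univ, Nat.cast_mul] at h
  -- the retained hypotheses
  have hq : ∀ i j, ζ i j * ws j / ηs = ζ i j * w j / LB := fun i j => by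
    rw [hws, hLB]; field_simp
  have hhead : -∑ i, ∑ j ∈ S, (ζ i j * w j / η) * Real.log (ζ i j * w j / η) =
      LB / η * Hs - LB / η * Real.log (LB / η) := by
    have hterm : ∀ i j, (ζ i j * w j / η) * Real.log (ζ i j * w j / η) =
        LB / η * ((ζ i j * w j / LB) * Real.log (ζ i j * w j / LB)) +
          (ζ i j * w j) * (Real.log (LB / η) / η) := fun i j => by
      have e : ζ i j * w j / η = (LB / η) * (ζ i j * w j / LB) := by field_simp
      rw [e, Real.log_mul (div_pos hLB0 hη0).ne' (div_pos (hζw i j) hLB0).ne']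
      field_simp
      ring
    simp only [hterm, Finset.sum_add_distrib, ← Finset.mul_sum, ← Finset.sum_mul, hA]
    simp only [hHs, hq]
    ring
  have ha1 : LB / η ≤ 1 := (div_le_one hη0).2 (by linarith)
  have ha0 : 0 < LB / η := div_pos hLB0 hη0
  have hHs0 : 0 ≤ Hs := (Real.log_nonneg hηs1).trans hHslog
  have hlogle : Real.log (LB / UB) ≤ Real.log (LB / η) :=
    Real.log_le_log (div_pos hLB0 hUB0) hfrac
  have hlog0 : Real.log (LB / η) ≤ 0 := Real.log_nonpos ha0.le ha1
  have hlogsplit : Real.log (LB / UB) = Real.log ηs + Real.log (W / UB) := by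
    rw [hLB, mul_div_assoc, Real.log_mul hηs0.ne' (div_pos hW0 hUB0).ne']
  have hcoef : W / LB * ηs = 1 := by rw [hLB]; field_simp
  rw [hH, hsplit, hws', hcoef, div_self hLB0.ne', neg_add, hhead]
  have h1 : LB / η * Hs ≤ Hs := mul_le_of_le_one_left hHs0 ha1
  have h2 : Real.log (LB / η) ≤ LB / η * Real.log (LB / η) := by nlinarith
  linarith
end

section
/- (Monotonicity of the upper bound on the measurement likelihood) Suppose σ > 0 and α : L → ℝ satisfy ζ i j ≤ σ·α i for all i ∈ L, j ∈ M. Let S and S' be nonempty subsets of M with S ⊆ S'. Then the upper bound UB[η](S) := ηˢ(S)·W(S) + (1 − W(S))·σ·∑_{i∈L} α i satisfies η ≤ UB[η](S') ≤ UB[η](S). Hence adding belief components to the distilled subset makes the upper bound of Theorem 4 tighter. -/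
/-- Multiplying the simplified likelihood by the retained mass cancels the renormalization, so the
upper bound is affine in the retained weights. -/
theorem likelihood_upper_bound_eq {L M : Type*} [Fintype L] (w : M → ℝ) (ζ : L → M → ℝ)
    (σ : ℝ) (α : L → ℝ) (S : Finset M) (hS : ∑ j ∈ S, w j ≠ 0) :
    (∑ i, ∑ j ∈ S, ζ i j * (w j / ∑ j ∈ S, w j)) * (∑ j ∈ S, w j)
        + (1 - ∑ j ∈ S, w j) * σ * ∑ i, α i =
      σ * ∑ i, α i - ∑ j ∈ S, w j * ∑ i, (σ * α i - ζ i j) := by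
  have hcancel : (∑ i, ∑ j ∈ S, ζ i j * (w j / ∑ j ∈ S, w j)) * (∑ j ∈ S, w j) =
      ∑ j ∈ S, w j * ∑ i, ζ i j := by
    rw [Finset.sum_comm, Finset.sum_mul]
    refine Finset.sum_congr rfl fun j _ => ?_
    rw [← Finset.sum_mul, mul_assoc, div_mul_cancel₀ _ hS, mul_comm]
  rw [hcancel]
  simp_rw [Finset.sum_sub_distrib, mul_sub, Finset.sum_sub_distrib, ← Finset.mul_sum,
    ← Finset.sum_mul]
  ring

/-- The affine form of the upper bound decreases as hypotheses are added. -/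
theorem likelihood_upper_bound_antitone {L M : Type*} [Fintype L] (w : M → ℝ) (ζ : L → M → ℝ)
    (hw : ∀ j, 0 ≤ w j) (σ : ℝ) (α : L → ℝ) (hζσα : ∀ i j, ζ i j ≤ σ * α i) :
    Antitone fun S : Finset M =>
      σ * ∑ i, α i - ∑ j ∈ S, w j * ∑ i, (σ * α i - ζ i j) := fun _ _ h =>
  sub_le_sub_left (Finset.sum_le_sum_of_subset_of_nonneg h fun j _ _ =>
    mul_nonneg (hw j) (Finset.sum_nonneg fun i _ => sub_nonneg.2 (hζσα i j))) _


/-- Monotonicity of the upper bound on the measurement likelihood: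
for nonempty `S ⊆ S' ⊆ M`, `η ≤ UB[η](S') ≤ UB[η](S)`. -/
theorem eta_upper_bound_monotone
    {L M : Type*} [Fintype L] [Fintype M] [Nonempty L] [Nonempty M]
    (w : M → ℝ) (ζ : L → M → ℝ)
    (hw : ∀ j, 0 < w j) (hw1 : ∑ j, w j = 1)
    (hζ : ∀ i j, 0 < ζ i j)
    (σ : ℝ) (α : L → ℝ) (hσ : 0 < σ)
    (hζσα : ∀ i j, ζ i j ≤ σ * α i)
    (S S' : Finset M) (hS : S.Nonempty) (hS' : S'.Nonempty) (hSS' : S ⊆ S')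
    (η : ℝ)
    (hη : η = ∑ i, ∑ j, ζ i j * w j) :
    η ≤ (∑ i, ∑ j ∈ S', ζ i j * (w j / ∑ j ∈ S', w j)) * (∑ j ∈ S', w j)
        + (1 - ∑ j ∈ S', w j) * σ * ∑ i, α i ∧
    (∑ i, ∑ j ∈ S', ζ i j * (w j / ∑ j ∈ S', w j)) * (∑ j ∈ S', w j)
        + (1 - ∑ j ∈ S', w j) * σ * ∑ i, α i ≤
      (∑ i, ∑ j ∈ S, ζ i j * (w j / ∑ j ∈ S, w j)) * (∑ j ∈ S, w j)
        + (1 - ∑ j ∈ S, w j) * σ * ∑ i, α i := by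
  have hanti := likelihood_upper_bound_antitone w ζ (fun j => (hw j).le) σ α hζσα
  have hmass : ∀ T : Finset M, T.Nonempty → ∑ j ∈ T, w j ≠ 0 := fun T hT =>
    (Finset.sum_pos (fun j _ => hw j) hT).ne'
  have hη_univ : η = σ * ∑ i, α i - ∑ j, w j * ∑ i, (σ * α i - ζ i j) := by
    rw [← likelihood_upper_bound_eq w ζ σ α Finset.univ (hmass _ Finset.univ_nonempty), hw1, hη]
    simp
  rw [likelihood_upper_bound_eq w ζ σ α S (hmass S hS),
    likelihood_upper_bound_eq w ζ σ α S' (hmass S' hS'), hη_univ]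
  exact ⟨hanti (Finset.subset_univ S'), hanti hSS'⟩
end
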